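/- For every integer n ≥ 2 and real t > 0, the set F_n(t) coincides with the set of isometry classes of finite metric spaces of diameter t having at most n points. That is, A ∈ GHSpace satisfies diam A = t and 2·d_GH(A, B) = diam B for every B ∈ B_n(t) if and only if A is the class of a finite metric space with at most n points and diameter t. -/

import Mathlib

/-- The metric on `Fin n` in which every nonzero distance equals `t`. -/
noncomputable def simplexMetric (n : ℕ) (t : ℝ) (ht : 0 < t) : MetricSpace (Fin n) where
  dist i j := if i = j then 0 else t
  dist_self i := by simp
  dist_comm i j := by by_cases h : i = j <;> simp [h, Ne.symm, eq_comm]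
  dist_triangle i j k := by
    by_cases h1 : i = k <;> by_cases h2 : i = j <;> by_cases h3 : j = k <;>
      simp_all <;> linarith
  eq_of_dist_eq_zero := by
    intro i j h
    by_cases hij : i = j
    · exact hij
    · simp [hij] at h; exact absurd h (ne_of_gt ht)

/-- The point of the Gromov–Hausdorff space corresponding to the simplex `tΔ_n`,
the `n`-point metric space all of whose nonzero distances equal `t`. -/
noncomputable def simplexGH (n : ℕ) (hn : 0 < n) (t : ℝ) (ht : 0 < t) :
    GromovHausdorff.GHSpace :=
  letI := simplexMetric n t ht
  haveI : Nonempty (Fin n) := ⟨⟨0, hn⟩⟩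
  GromovHausdorff.toGHSpace (Fin n)

/-- The class `Δ₁` of the one-point metric space. -/
noncomputable def onePointGH : GromovHausdorff.GHSpace := simplexGH 1 one_pos 1 one_pos

/-- The diameter of (a representative of) a point of the Gromov–Hausdorff space. -/
noncomputable def ghDiam (X : GromovHausdorff.GHSpace) : ℝ :=
  Metric.diam (Set.univ : Set X.Rep)

open Metric in
/-- A correspondence of distortion at most `2r` bounds the Gromov–Hausdorff distance by `r`. -/
theorem gh_dist_le_of_correspondence {p q : GromovHausdorff.GHSpace} {r : ℝ} (hr : 0 < r)
    (R : p.Rep → q.Rep → Prop) (hl : ∀ x, ∃ y, R x y) (hR : ∀ y, ∃ x, R x y)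
    (hd : ∀ x y x' y', R x y → R x' y' → |dist x x' - dist y y'| ≤ 2 * r) :
    dist p q ≤ r := by
  let Z := {z : p.Rep × q.Rep // R z.1 z.2}
  let Φ : Z → p.Rep := fun z => z.1.1
  let Ψ : Z → q.Rep := fun z => z.1.2
  have : Nonempty Z := by
    obtain ⟨x⟩ := (inferInstance : Nonempty p.Rep)
    obtain ⟨y, hy⟩ := hl x
    exact ⟨⟨(x, y), hy⟩⟩
  let : MetricSpace (p.Rep ⊕ q.Rep) := glueMetricApprox Φ Ψ r hr
    fun a b => hd _ _ _ _ a.2 b.2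
  have hi : Isometry (Sum.inl : p.Rep → p.Rep ⊕ q.Rep) := Isometry.of_dist_eq fun _ _ => rfl
  have hj : Isometry (Sum.inr : q.Rep → p.Rep ⊕ q.Rep) := Isometry.of_dist_eq fun _ _ => rfl
  have hg : ∀ x y, R x y → dist (Sum.inl x : p.Rep ⊕ q.Rep) (Sum.inr y) = r := fun x y h =>
    glueDist_glued_points Φ Ψ r (⟨(x, y), h⟩ : Z)
  rw [GromovHausdorff.dist_ghDist]
  refine (GromovHausdorff.ghDist_le_hausdorffDist hi hj).trans
    (hausdorffDist_le_of_mem_dist hr.le ?_ ?_)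
  · rintro _ ⟨x, rfl⟩
    obtain ⟨y, hy⟩ := hl x
    exact ⟨_, ⟨y, rfl⟩, (hg x y hy).le⟩
  · rintro _ ⟨y, rfl⟩
    obtain ⟨x, hx⟩ := hR y
    exact ⟨_, ⟨x, rfl⟩, by rw [dist_comm]; exact (hg x y hx).le⟩

open Metric in
/-- Spaces at Gromov–Hausdorff distance less than `r` admit a correspondence of distortion
at most `2r`. -/
theorem exists_correspondence_of_gh_dist_lt {p q : GromovHausdorff.GHSpace} {r : ℝ}
    (h : dist p q < r) :
    ∃ R : p.Rep → q.Rep → Prop, (∀ x, ∃ y, R x y) ∧ (∀ y, ∃ x, R x y) ∧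
      ∀ x y x' y', R x y → R x' y' → |dist x x' - dist y y'| ≤ 2 * r := by
  rw [GromovHausdorff.dist_ghDist] at h
  obtain ⟨Φ, Ψ, hΦ, hΨ, he⟩ := GromovHausdorff.ghDist_eq_hausdorffDist p.Rep q.Rep
  rw [he] at h
  have fin := hausdorffEDist_ne_top_of_nonempty_of_bounded (Set.range_nonempty Φ)
    (Set.range_nonempty Ψ) (isCompact_range hΦ.continuous).isBounded
    (isCompact_range hΨ.continuous).isBounded
  refine ⟨fun x y => dist (Φ x) (Ψ y) ≤ r, fun x => ?_, fun y => ?_, ?_⟩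
  · obtain ⟨_, ⟨y, rfl⟩, hy⟩ := exists_dist_lt_of_hausdorffDist_lt (Set.mem_range_self x) h fin
    exact ⟨y, hy.le⟩
  · obtain ⟨_, ⟨x, rfl⟩, hx⟩ := exists_dist_lt_of_hausdorffDist_lt' (Set.mem_range_self y) h fin
    exact ⟨x, hx.le⟩
  · intro x y x' y' hxy hxy'
    rw [← hΦ.dist_eq, ← hΨ.dist_eq, abs_le]
    have h1 := dist_triangle4 (Φ x) (Ψ y) (Ψ y') (Φ x')
    have h2 := dist_triangle4 (Ψ y) (Φ x) (Φ x') (Ψ y')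
    rw [dist_comm (Ψ y') (Φ x')] at h1
    rw [dist_comm (Ψ y) (Φ x)] at h2
    constructor <;> linarith

theorem dist_le_ghDiam {p : GromovHausdorff.GHSpace} (x y : p.Rep) : dist x y ≤ ghDiam p :=
  Metric.dist_le_diam_of_mem isCompact_univ.isBounded (Set.mem_univ x) (Set.mem_univ y)

theorem ghDiam_le {p : GromovHausdorff.GHSpace} {c : ℝ} (h : ∀ x y : p.Rep, dist x y ≤ c) :
    ghDiam p ≤ c := by
  obtain ⟨x⟩ := (inferInstance : Nonempty p.Rep)
  exact Metric.diam_le_of_forall_dist_le (dist_nonneg.trans (h x x)) fun x _ y _ => h x y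

/-- Twice the Gromov–Hausdorff distance is at most the larger diameter. -/
theorem two_mul_gh_dist_le {p q : GromovHausdorff.GHSpace} {c : ℝ} (hc : 0 < c)
    (hp : ghDiam p ≤ c) (hq : ghDiam q ≤ c) : 2 * dist p q ≤ c := by
  have : dist p q ≤ c / 2 := by
    refine gh_dist_le_of_correspondence (half_pos hc) (fun _ _ => True)
      (fun _ => by simp)
      (fun _ => by simp) fun x y x' y' _ _ => ?_
    have h1 := (dist_le_ghDiam x x').trans hp
    have h2 := (dist_le_ghDiam y y').trans hq
    rw [abs_le]
    constructor <;> linarith [dist_nonneg (x := x) (y := x'), dist_nonneg (x := y) (y := y')]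
  linarith

/-- A space close to an image of `Fin n` is covered by `n` nonempty sets of small diameter. -/
theorem exists_cover_of_gh_dist_lt {p q : GromovHausdorff.GHSpace} {r : ℝ} {n : ℕ}
    (e : Fin n → p.Rep) (he : Function.Surjective e) (h : dist p q < r) :
    ∃ S : Fin n → Set q.Rep, (∀ i, (S i).Nonempty) ∧ (∀ y, ∃ i, y ∈ S i) ∧
      ∀ i, ∀ y ∈ S i, ∀ y' ∈ S i, dist y y' ≤ 2 * r := by
  obtain ⟨R, hl, hR, hd⟩ := exists_correspondence_of_gh_dist_lt h
  refine ⟨fun i => {y | R (e i) y}, fun i => hl _, fun y => ?_, fun i y hy y' hy' => ?_⟩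
  · obtain ⟨x, hx⟩ := hR y
    obtain ⟨i, rfl⟩ := he x
    exact ⟨i, hx⟩
  · have := hd _ _ _ _ hy hy'
    rw [dist_self, zero_sub, abs_neg] at this
    exact (le_abs_self _).trans this

theorem nonempty_rep_isometryEquiv (X : Type*) [MetricSpace X] [CompactSpace X] [Nonempty X] :
    Nonempty ((GromovHausdorff.toGHSpace X).Rep ≃ᵢ X) :=
  GromovHausdorff.toGHSpace_eq_toGHSpace_iff_isometryEquiv.1
    (GromovHausdorff.GHSpace.toGHSpace_rep _)

theorem exists_simplexGH_equiv (n : ℕ) (hn : 0 < n) (t : ℝ) (ht : 0 < t) :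
    ∃ e : Fin n → (simplexGH n hn t ht).Rep, Function.Surjective e ∧
      (∀ i, dist (e i) (e i) = 0) ∧ ∀ i j, i ≠ j → dist (e i) (e j) = t := by
  let := simplexMetric n t ht
  have : Nonempty (Fin n) := ⟨⟨0, hn⟩⟩
  obtain ⟨f⟩ := nonempty_rep_isometryEquiv (Fin n)
  refine ⟨f.symm, f.symm.surjective, fun i => dist_self _, fun i j hij => ?_⟩
  exact (f.symm.isometry.dist_eq i j).trans (if_neg hij)

theorem ghDiam_simplexGH_le (n : ℕ) (hn : 0 < n) (t : ℝ) (ht : 0 < t) :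
    ghDiam (simplexGH n hn t ht) ≤ t := by
  obtain ⟨e, he, h0, h1⟩ := exists_simplexGH_equiv n hn t ht
  refine ghDiam_le fun x y => ?_
  obtain ⟨i, rfl⟩ := he x
  obtain ⟨j, rfl⟩ := he y
  by_cases h : i = j
  · subst h; rw [h0]; exact ht.le
  · exact (h1 i j h).le

theorem ghDiam_onePointGH : ghDiam onePointGH ≤ 0 := by
  obtain ⟨e, he, h0, -⟩ := exists_simplexGH_equiv 1 one_pos 1 one_pos
  refine ghDiam_le fun x y => ?_
  obtain ⟨i, rfl⟩ := he x
  obtain ⟨j, rfl⟩ := he y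
  rw [Subsingleton.elim j i]
  exact (h0 i).le

theorem two_mul_dist_onePointGH {B : GromovHausdorff.GHSpace} (hB : 0 < ghDiam B) :
    2 * dist B onePointGH = ghDiam B := by
  refine le_antisymm (two_mul_gh_dist_le hB le_rfl (ghDiam_onePointGH.trans hB.le)) ?_
  by_contra! hlt
  obtain ⟨r, hr, hr'⟩ := exists_between (show dist onePointGH B < ghDiam B / 2 by
    rw [dist_comm]; linarith)
  obtain ⟨e, he, -⟩ := exists_simplexGH_equiv 1 one_pos 1 one_pos
  obtain ⟨S, -, hS, hd⟩ := exists_cover_of_gh_dist_lt e he hr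
  have : ghDiam B ≤ 2 * r := ghDiam_le fun x y => by
    obtain ⟨i, hi⟩ := hS x
    obtain ⟨j, hj⟩ := hS y
    rw [Subsingleton.elim j i] at hj
    exact hd i x hi y hj
  linarith

/-- A space of diameter at least `2t` covered by `n` nonempty sets of smaller diameter is closer
to `tΔ_n` than half its diameter. -/
theorem two_mul_dist_simplexGH_lt {B : GromovHausdorff.GHSpace} {n : ℕ} (hn : 0 < n) {t r : ℝ}
    (ht : 0 < t) (hB : 2 * t ≤ ghDiam B) (hr : 2 * r < ghDiam B) (S : Fin n → Set B.Rep)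
    (hne : ∀ i, (S i).Nonempty) (hS : ∀ y, ∃ i, y ∈ S i)
    (hd : ∀ i, ∀ y ∈ S i, ∀ y' ∈ S i, dist y y' ≤ 2 * r) :
    2 * dist B (simplexGH n hn t ht) < ghDiam B := by
  obtain ⟨e, he, h0, h1⟩ := exists_simplexGH_equiv n hn t ht
  set r' := max r ((ghDiam B - t) / 2)
  have hle1 : r ≤ r' := le_max_left _ _
  have hle2 : (ghDiam B - t) / 2 ≤ r' := le_max_right _ _
  have hlt : r' < ghDiam B / 2 := max_lt (by linarith) (by linarith)
  have := gh_dist_le_of_correspondence (p := B) (q := simplexGH n hn t ht) (r := r')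
    (by linarith) (fun b s => ∃ i, s = e i ∧ b ∈ S i)
    (fun b => by obtain ⟨i, hi⟩ := hS b; exact ⟨e i, i, rfl, hi⟩)
    (fun s => by
      obtain ⟨i, rfl⟩ := he s
      obtain ⟨b, hb⟩ := hne i
      exact ⟨b, i, rfl, hb⟩)
    (by
      rintro x _ x' _ ⟨i, rfl, hi⟩ ⟨j, rfl, hj⟩
      by_cases hij : i = j
      · subst hij
        rw [h0, sub_zero, abs_of_nonneg dist_nonneg]
        linarith [hd i x hi x' hj]
      · rw [h1 i j hij, abs_le]
        constructor <;> linarith [dist_le_ghDiam x x', dist_nonneg (x := x) (y := x')])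
  linarith

open Metric in
/-- A space of diameter at most `t` together with `m` extra points at distance `t` from it and at
mutual distances `2t`. -/
theorem exists_extension_by_simplex (A : GromovHausdorff.GHSpace) {t : ℝ} (ht : 0 < t)
    (hA : ghDiam A ≤ t) {m : ℕ} (hm : 0 < m) :
    ∃ (B : GromovHausdorff.GHSpace) (i : A.Rep → B.Rep) (j : Fin m → B.Rep),
      (∀ x y, dist (i x) (i y) = dist x y) ∧ (∀ a b, a ≠ b → dist (j a) (j b) = 2 * t) ∧
      (∀ x a, dist (i x) (j a) = t) ∧ ∀ b, (∃ x, i x = b) ∨ ∃ a, j a = b := by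
  have h2t : 0 < 2 * t := by linarith
  obtain ⟨e, he, -, h1⟩ := exists_simplexGH_equiv m hm (2 * t) h2t
  have hq := ghDiam_simplexGH_le m hm (2 * t) h2t
  let q := simplexGH m hm (2 * t) h2t
  let : MetricSpace (A.Rep ⊕ q.Rep) :=
    glueMetricApprox (Z := A.Rep × q.Rep) Prod.fst Prod.snd t ht fun a b => by
      rw [abs_le]
      constructor <;> linarith [dist_le_ghDiam a.1 b.1, dist_le_ghDiam a.2 b.2,
        dist_nonneg (x := a.1) (y := b.1), dist_nonneg (x := a.2) (y := b.2)]
  obtain ⟨f⟩ := nonempty_rep_isometryEquiv (A.Rep ⊕ q.Rep)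
  refine ⟨GromovHausdorff.toGHSpace (A.Rep ⊕ q.Rep), fun x => f.symm (Sum.inl x),
    fun a => f.symm (Sum.inr (e a)), fun x y => ?_, fun a b hab => ?_, fun x a => ?_, fun b => ?_⟩
  · rw [f.symm.isometry.dist_eq]; rfl
  · rw [f.symm.isometry.dist_eq]; exact h1 a b hab
  · rw [f.symm.isometry.dist_eq]
    exact glueDist_glued_points (Z := A.Rep × q.Rep) Prod.fst Prod.snd t (x, e a)
  · obtain ⟨z, rfl⟩ := f.symm.surjective b
    rcases z with x | y
    · exact Or.inl ⟨x, rfl⟩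
    · obtain ⟨a, rfl⟩ := he y
      exact Or.inr ⟨a, rfl⟩

theorem Finite.exists_pos_le_dist {X ι : Type*} [MetricSpace X] [Finite ι] {a : ι → X}
    (ha : Function.Injective a) : ∃ δ > 0, ∀ i j, i ≠ j → δ ≤ dist (a i) (a j) := by
  cases nonempty_fintype ι
  by_cases hne : Nonempty {z : ι × ι // z.1 ≠ z.2}
  · obtain ⟨z, hz⟩ := Finite.exists_min
      fun z : {z : ι × ι // z.1 ≠ z.2} => dist (a z.1.1) (a z.1.2)
    exact ⟨_, dist_pos.2 (ha.ne z.2), fun i j hij => hz ⟨(i, j), hij⟩⟩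
  · exact ⟨1, one_pos, fun i j hij => (hne ⟨⟨(i, j), hij⟩⟩).elim⟩

/-- A space of diameter `t` with more than `n` points is too close to some element
of `𝓑_n(t)`. -/
theorem exists_two_mul_dist_lt_of_injective {A : GromovHausdorff.GHSpace} {n : ℕ} (hn : 0 < n)
    {t : ℝ} (ht : 0 < t) (hA : ghDiam A ≤ t) (a : Fin (n + 1) → A.Rep)
    (ha : Function.Injective a) :
    ∃ B : GromovHausdorff.GHSpace, dist B onePointGH = dist B (simplexGH n hn t ht) ∧
      2 * t ≤ ghDiam B ∧ 2 * dist A B < ghDiam B := by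
  obtain ⟨B, i, j, hi, hj, hij, hB⟩ := exists_extension_by_simplex A ht hA n.succ_pos
  have hle : ∀ x y : A.Rep, dist x y ≤ t := fun x y => (dist_le_ghDiam x y).trans hA
  have hdiam : ghDiam B = 2 * t := by
    refine le_antisymm (ghDiam_le fun x y => ?_) ?_
    · rcases hB x with ⟨x, rfl⟩ | ⟨b, rfl⟩ <;> rcases hB y with ⟨y, rfl⟩ | ⟨c, rfl⟩
      · rw [hi]; linarith [hle x y]
      · rw [hij]; linarith
      · rw [dist_comm, hij]; linarith
      · by_cases hbc : b = c
        · rw [hbc, dist_self]; linarith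
        · exact (hj b c hbc).le
    · have h01 : (0 : Fin (n + 1)) ≠ Fin.last n := by
        simpa [Fin.ext_iff] using hn.ne
      rw [← hj _ _ h01]
      exact dist_le_ghDiam _ _
  refine ⟨B, ?_, hdiam.ge, ?_⟩
  · have h1 := two_mul_dist_onePointGH (B := B) (by linarith)
    have h2 : 2 * dist B (simplexGH n hn t ht) ≤ ghDiam B := two_mul_gh_dist_le (by linarith) le_rfl
      ((ghDiam_simplexGH_le n hn t ht).trans (by linarith))
    have h3 : t ≤ dist B (simplexGH n hn t ht) := by
      by_contra! hlt
      rw [dist_comm] at hlt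
      obtain ⟨r, hr, hrt⟩ := exists_between hlt
      obtain ⟨e, he, -⟩ := exists_simplexGH_equiv n hn t ht
      obtain ⟨S, -, hS, hd⟩ := exists_cover_of_gh_dist_lt e he hr
      choose g hg using fun b => hS (j b)
      obtain ⟨b, c, hbc, hgbc⟩ := Fintype.exists_ne_map_eq_of_card_lt g (by simp)
      have := hd (g b) _ (hg b) _ (hgbc ▸ hg c)
      rw [hj b c hbc] at this
      linarith
    linarith
  · obtain ⟨δ, hδ, hsep⟩ := Finite.exists_pos_le_dist ha
    set r := max (t / 2) (t - δ / 2)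
    have hr1 : t / 2 ≤ r := le_max_left _ _
    have hr2 : t - δ / 2 ≤ r := le_max_right _ _
    have hrt : r < t := max_lt (by linarith) (by linarith)
    have := gh_dist_le_of_correspondence (p := A) (q := B) (r := r) (by linarith)
      (fun x b => i x = b ∨ ∃ c, x = a c ∧ j c = b) (fun x => ⟨i x, Or.inl rfl⟩)
      (fun b => by
        rcases hB b with ⟨x, hx⟩ | ⟨c, hc⟩
        · exact ⟨x, Or.inl hx⟩
        · exact ⟨a c, Or.inr ⟨c, rfl, hc⟩⟩)
      (by
        have hmix : ∀ x y : A.Rep, |dist x y - t| ≤ 2 * r := fun x y => by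
          rw [abs_le]
          constructor <;> linarith [hle x y, dist_nonneg (x := x) (y := y)]
        rintro x _ x' _ (rfl | ⟨b, rfl, rfl⟩) (rfl | ⟨c, rfl, rfl⟩)
        · rw [hi, sub_self, abs_zero]; linarith
        · rw [hij]; exact hmix _ _
        · rw [dist_comm (j b), hij]; exact hmix _ _
        · by_cases hbc : b = c
          · subst hbc
            rw [dist_self, dist_self, sub_self, abs_zero]; linarith
          · rw [hj b c hbc, abs_le]
            constructor <;> linarith [hle (a b) (a c), hsep b c hbc])
    linarith

/-- **Characterization of `𝓕_n(t)`.** A point `A` of the Gromov–Hausdorff space satisfies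
`diam A = t` and `2 d_GH(A, B) = diam B` for every `B ∈ 𝓑_n(t)` (i.e. every `B` with
`d_GH(B, Δ₁) = d_GH(B, tΔ_n)` and `diam B ≥ 2t`) if and only if `A` is the class of a
finite metric space with at most `n` points and diameter `t`. -/
theorem Fnt_eq_finite_spaces (n : ℕ) (hn : 2 ≤ n) (t : ℝ) (ht : 0 < t)
    (A : GromovHausdorff.GHSpace) :
    (ghDiam A = t ∧
      ∀ B : GromovHausdorff.GHSpace,
        dist B onePointGH = dist B (simplexGH n (by omega) t ht) → 2 * t ≤ ghDiam B →
          2 * dist A B = ghDiam B) ↔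
    (Finite A.Rep ∧ Nat.card A.Rep ≤ n ∧ ghDiam A = t) := by
  constructor
  · rintro ⟨hA, hAB⟩
    by_contra hcon
    obtain ⟨a⟩ : Nonempty (Fin (n + 1) ↪ A.Rep) := by
      cases finite_or_infinite A.Rep with
      | inl hfin =>
        have hcard : n + 1 ≤ Nat.card A.Rep := by
          by_contra! hlt
          exact hcon ⟨hfin, by omega, hA⟩
        cases nonempty_fintype A.Rep
        exact Function.Embedding.nonempty_of_card_le (by simpa using hcard)
      | inr hinf => exact ⟨Fin.valEmbedding.trans (Infinite.natEmbedding _)⟩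
    obtain ⟨B, hB, hdiam, hlt⟩ :=
      exists_two_mul_dist_lt_of_injective (by omega) ht hA.le a a.injective
    exact hlt.ne (hAB B hB hdiam)
  · rintro ⟨hfin, hcard, hA⟩
    refine ⟨hA, fun B hB hdiam => ?_⟩
    refine le_antisymm (two_mul_gh_dist_le (by linarith) (by linarith) le_rfl) ?_
    by_contra! hlt
    obtain ⟨r, hr, hr'⟩ := exists_between (show dist A B < ghDiam B / 2 by linarith)
    obtain ⟨e, he⟩ : ∃ e : Fin n → A.Rep, Function.Surjective e := by
      cases nonempty_fintype A.Rep
      obtain ⟨g⟩ := Function.Embedding.nonempty_of_card_le (α := A.Rep) (β := Fin n)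
        (by simpa using hcard)
      exact ⟨_, Function.invFun_surjective g.injective⟩
    obtain ⟨S, hne, hS, hd⟩ := exists_cover_of_gh_dist_lt e he hr
    have h1 := two_mul_dist_simplexGH_lt (by omega) ht hdiam (by linarith) S hne hS hd
    have h2 := two_mul_dist_onePointGH (B := B) (by linarith)
    rw [hB] at h2
    exact h1.ne h2
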